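/- arXiv:2008.01538 — 5 statements merged into one kernel-verified Lean document; each statement's English description precedes it below -/
import Mathlib

section
/- Let L be a first-order language and let α and β be sets of variables. Regard the term algebras L.Term α and L.Term β as L-structures in the canonical way (each n-ary function symbol f acts on terms t₁,…,tₙ by forming the term f(t₁,…,tₙ)). If there exists an isomorphism of L-structures between L.Term α and L.Term β, then the cardinality of α equals the cardinality of β. -/
open FirstOrder Language

/-- The canonical `L`-structure on the term algebra `L.Term α`: each `n`-ary function
symbol acts by forming the corresponding term, and there are (vacuously) no relations. -/
instance termAlgebraStructure (L : FirstOrder.Language) (α : Type*) :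
    L.Structure (L.Term α) where
  funMap f ts := FirstOrder.Language.Term.func f ts
  RelMap _ _ := False

/-- An isomorphism of term algebras sends variables to variables. -/
theorem exists_var_eq_of_termAlgebra_equiv {L : FirstOrder.Language} {α β : Type*}
    (e : L.Term α ≃[L] L.Term β) (a : α) :
    ∃ b : β, e (.var a) = .var b := by
  cases h : e (.var a) with
  | var b => exact ⟨b, rfl⟩
  | func f ts =>
    have key : e.symm (.func f ts) = .func f (e.symm ∘ ts) := e.symm.map_fun f ts
    rw [← h, e.symm_apply_apply] at key
    cases key

/-- An isomorphism of term algebras bounds the cardinality of the generators. -/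
theorem mk_le_mk_of_termAlgebra_equiv {L : FirstOrder.Language} {α β : Type u}
    (e : L.Term α ≃[L] L.Term β) : Cardinal.mk α ≤ Cardinal.mk β := by
  choose g hg using exists_var_eq_of_termAlgebra_equiv e
  refine Cardinal.mk_le_of_injective (f := g) fun a a' h => ?_
  exact FirstOrder.Language.Term.var.inj (e.injective (by rw [hg, hg, h]))

/-- If two absolutely free term algebras are isomorphic as `L`-structures, then their
sets of generators are equinumerous. -/
theorem term_algebra_iso_iff_card_eq {L : FirstOrder.Language} {α β : Type u}
    (h : Nonempty (L.Term α ≃[L] L.Term β)) :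
    Cardinal.mk α = Cardinal.mk β := by
  obtain ⟨e⟩ := h
  exact (mk_le_mk_of_termAlgebra_equiv e).antisymm (mk_le_mk_of_termAlgebra_equiv e.symm)
end

section
/- If e : FreeMagma α ≃* FreeMagma β is a multiplicative isomorphism of free magmas, then e maps generators to generators: for every x : α there exists y : β such that e (FreeMagma.of x) = FreeMagma.of y. -/
/-- A multiplicative isomorphism of free magmas maps generators to generators. -/
theorem mulEquiv_of_mem_range_of {α β : Type*} (e : FreeMagma α ≃* FreeMagma β)
    (x : α) : ∃ y : β, e (FreeMagma.of x) = FreeMagma.of y := by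
  rcases h : e (FreeMagma.of x) with y | ⟨s, t⟩
  · exact ⟨y, rfl⟩
  · have hx : FreeMagma.of x = e.symm s * e.symm t := by
      rw [← map_mul, MulEquiv.eq_symm_apply]
      exact h
    exact nomatch hx
end

section
/- If there exists a multiplicative isomorphism FreeMagma α ≃* FreeMagma β, then there exists a bijection between α and β. -/
namespace FreeMagma

theorem of_injective {α : Type*} : Function.Injective (of : α → FreeMagma α) :=
  fun _ _ h ↦ FreeMagma.noConfusion rfl (heq_of_eq h) eq_of_heq

/-- The generators of a free magma are exactly its indecomposable elements. -/
theorem mem_range_of_iff {α : Type*} {x : FreeMagma α} :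
    x ∈ Set.range of ↔ ∀ y z, x ≠ y * z := by
  constructor
  · rintro ⟨a, rfl⟩ y z h
    cases h
  · intro h
    cases x using FreeMagma.recOnMul with
    | ih1 a => exact ⟨a, rfl⟩
    | ih2 y z => exact absurd rfl (h y z)

/-- An isomorphism of free magmas preserves the generators in both directions. -/
theorem map_mem_range_of_iff {α β : Type*} (e : FreeMagma α ≃* FreeMagma β) {x : FreeMagma α} :
    e x ∈ Set.range of ↔ x ∈ Set.range of := by
  simp only [mem_range_of_iff, e.surjective.forall, ← map_mul, e.injective.ne_iff]

end FreeMagma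

/-- Isomorphic free magmas have equinumerous generating sets. -/
theorem freeMagma_iso_gives_equiv {α β : Type*}
    (h : Nonempty (FreeMagma α ≃* FreeMagma β)) : Nonempty (α ≃ β) := by
  obtain ⟨e⟩ := h
  exact ⟨(Equiv.ofInjective _ FreeMagma.of_injective).trans <|
    (e.toEquiv.subtypeEquiv fun _ ↦ (FreeMagma.map_mem_range_of_iff e).symm).trans
      (Equiv.ofInjective _ FreeMagma.of_injective).symm⟩
end

section
/- If there exists a multiplicative isomorphism FreeSemigroup α ≃* FreeSemigroup β, then there exists a bijection between α and β. -/
namespace FreeSemigroup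

theorem of_injective {α : Type*} : Function.Injective (of : α → FreeSemigroup α) :=
  fun _ _ hab => congrArg head hab

/-- The free generators are exactly the elements that are not products. -/
theorem mem_range_of_iff_forall_ne_mul {α : Type*} {x : FreeSemigroup α} :
    x ∈ Set.range of ↔ ∀ y z, x ≠ y * z := by
  constructor
  · rintro ⟨a, rfl⟩ y z hyz
    have hlen := congrArg length hyz
    simp only [length_of, length_mul] at hlen
    have hy : 0 < y.length := Nat.succ_pos _
    have hz : 0 < z.length := Nat.succ_pos _
    omega
  · induction x using FreeSemigroup.recOnMul with
    | ih1 a => exact fun _ => ⟨a, rfl⟩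
    | ih2 a y => exact fun hx => (hx _ _ rfl).elim

theorem _root_.MulEquiv.apply_mem_range_freeSemigroup_of_iff {α β : Type*}
    (e : FreeSemigroup α ≃* FreeSemigroup β) {x : FreeSemigroup α} :
    e x ∈ Set.range of ↔ x ∈ Set.range of := by
  simp only [mem_range_of_iff_forall_ne_mul, e.surjective.forall, ← map_mul, e.injective.ne_iff]

end FreeSemigroup

/-- Isomorphic free semigroups have equinumerous generating sets. -/
theorem freeSemigroup_iso_gives_equiv {α β : Type*}
    (h : Nonempty (FreeSemigroup α ≃* FreeSemigroup β)) : Nonempty (α ≃ β) := by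
  obtain ⟨e⟩ := h
  exact ⟨(Equiv.ofInjective _ FreeSemigroup.of_injective).trans <|
    (e.toEquiv.subtypeEquiv fun _ => e.apply_mem_range_freeSemigroup_of_iff.symm).trans
      (Equiv.ofInjective _ FreeSemigroup.of_injective).symm⟩
end

section
/- Let k be a field and let L = FreeLieAlgebra k X be the free Lie algebra over k on a type X. Then the quotient of L by its derived ideal ⁅L, L⁆ (the Lie ideal generated by all brackets) is isomorphic as a k-vector space to the free k-module on X, i.e., L ⧸ ⁅⊤, ⊤⁆ ≃ₗ[k] (X →₀ k). -/
/-- The Lie ring structure on an additive commutative group with zero bracket. -/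
abbrev LieRing.ofZeroBracket (M : Type*) [AddCommGroup M] : LieRing M where
  bracket _ _ := 0
  add_lie _ _ _ := (add_zero 0).symm
  lie_add _ _ _ := (add_zero 0).symm
  lie_self _ := rfl
  leibniz_lie _ _ _ := (add_zero 0).symm

/-- The Lie algebra structure on a module with zero bracket. -/
abbrev LieAlgebra.ofZeroBracket (R M : Type*) [CommRing R] [AddCommGroup M] [Module R M] :
    letI := LieRing.ofZeroBracket M
    LieAlgebra R M :=
  letI := LieRing.ofZeroBracket M
  { lie_smul := fun t _ _ => (smul_zero t).symm }

namespace FreeLieAlgebra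

variable {R X M : Type*} [CommRing R] [AddCommGroup M] [Module R M]

/-- Every function from the generators to a module extends to a linear map on the free Lie algebra
which vanishes on brackets. -/
theorem exists_linearMap_lie_eq_zero (f : X → M) :
    ∃ F : FreeLieAlgebra R X →ₗ[R] M,
      (∀ x, F (of R x) = f x) ∧ ∀ a b : FreeLieAlgebra R X, F ⁅a, b⁆ = 0 := by
  let := LieRing.ofZeroBracket M
  let := LieAlgebra.ofZeroBracket R M
  exact ⟨(lift R f).toLinearMap, fun x => lift_of_apply f x, fun a b => (lift R f).map_lie a b⟩

/-- Linear maps which vanish on brackets are determined by their values on the generators. -/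
theorem linearMap_ext_of_lie_eq_zero {F G : FreeLieAlgebra R X →ₗ[R] M}
    (hF : ∀ a b : FreeLieAlgebra R X, F ⁅a, b⁆ = 0)
    (hG : ∀ a b : FreeLieAlgebra R X, G ⁅a, b⁆ = 0)
    (h : ∀ x, F (of R x) = G (of R x)) : F = G := by
  let := LieRing.ofZeroBracket M
  let := LieAlgebra.ofZeroBracket R M
  let F' : FreeLieAlgebra R X →ₗ⁅R⁆ M := { F with map_lie' := fun {a b} => hF a b }
  let G' : FreeLieAlgebra R X →ₗ⁅R⁆ M := { G with map_lie' := fun {a b} => hG a b }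
  have hFG : F' = G' := hom_ext h
  exact LinearMap.ext fun a => LieHom.congr_fun hFG a

/-- The abelianization of a free Lie algebra is the free module on the generators. -/
theorem nonempty_quotient_derived_linearEquiv_finsupp (R X : Type*) [CommRing R] :
    Nonempty
      ((FreeLieAlgebra R X ⧸
          ⁅(⊤ : LieIdeal R (FreeLieAlgebra R X)), (⊤ : LieIdeal R (FreeLieAlgebra R X))⁆)
        ≃ₗ[R] (X →₀ R)) := by
  let I := ⁅(⊤ : LieIdeal R (FreeLieAlgebra R X)), (⊤ : LieIdeal R (FreeLieAlgebra R X))⁆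
  obtain ⟨F, hF_of, hF_lie⟩ :=
    exists_linearMap_lie_eq_zero (R := R) fun x : X => Finsupp.single x (1 : R)
  have hI : I.toSubmodule ≤ LinearMap.ker F := by
    rw [LieSubmodule.lieIdeal_oper_eq_linear_span', Submodule.span_le]
    rintro _ ⟨a, -, b, -, rfl⟩
    exact hF_lie a b
  let G := Finsupp.linearCombination R fun x : X => I.toSubmodule.mkQ (of R x)
  have hGF : G ∘ₗ F = I.toSubmodule.mkQ := by
    refine linearMap_ext_of_lie_eq_zero (fun a b => by simp [hF_lie]) (fun a b => ?_)
      fun x => by simp [hF_of, G]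
    rw [Submodule.mkQ_apply, Submodule.Quotient.mk_eq_zero]
    exact LieSubmodule.lie_mem_lie (LieSubmodule.mem_top a) (LieSubmodule.mem_top b)
  refine ⟨LinearEquiv.ofLinearMap (I.toSubmodule.liftQ F hI) G ?_ ?_⟩
  · ext x : 2
    simp only [LinearMap.comp_apply, Finsupp.lsingle_apply, G, Finsupp.linearCombination_single,
      one_smul, LinearMap.id_apply]
    exact hF_of x
  · refine Submodule.linearMap_qext _ ?_
    rw [LinearMap.comp_assoc, Submodule.liftQ_mkQ, hGF, LinearMap.id_comp]

end FreeLieAlgebra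

/-- The quotient of the free Lie algebra on `X` over a field `k` by its derived ideal is
isomorphic, as a `k`-vector space, to the free `k`-module on `X`. -/
theorem freeLieAlgebra_quotient_derived_ideal {k : Type*} [Field k] (X : Type*) :
    Nonempty
      ((FreeLieAlgebra k X ⧸
          ⁅(⊤ : LieIdeal k (FreeLieAlgebra k X)), (⊤ : LieIdeal k (FreeLieAlgebra k X))⁆)
        ≃ₗ[k] (X →₀ k)) :=
  FreeLieAlgebra.nonempty_quotient_derived_linearEquiv_finsupp k X
end
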